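/- arXiv:2112.04844 — 2 statements merged into one kernel-verified Lean document; each statement's English description precedes it below -/
import Mathlib

section
/- Let G be a connected finite simple graph with independence number α(G) ≤ 2. Then G contains two odd cycles that are not adjacent to each other if and only if G contains an induced subgraph isomorphic to one of the graphs 𝔾₃, 𝔾₄, 𝔾₅. -/
/-- `G` contains two odd cycles which are not adjacent to each other:
they share no vertex and no vertex of one is adjacent to a vertex of the other. -/
def HasTwoNonAdjOddCycles {V : Type*} (G : SimpleGraph V) : Prop :=
  ∃ (v₁ v₂ : V) (c₁ : G.Walk v₁ v₁) (c₂ : G.Walk v₂ v₂),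
    c₁.IsCycle ∧ c₂.IsCycle ∧ Odd c₁.length ∧ Odd c₂.length ∧
      ∀ x ∈ c₁.support, ∀ y ∈ c₂.support, x ≠ y ∧ ¬G.Adj x y

/-- The graph `𝔾₃` of the paper, on vertices `{1,…,7}` (here `0`-indexed as `Fin 7`). -/
def G3 : SimpleGraph (Fin 7) :=
  SimpleGraph.fromEdgeSet
    ({s(0, 1), s(0, 2), s(1, 2), s(3, 4), s(3, 5), s(4, 5),
      s(2, 6), s(3, 6), s(4, 6), s(5, 6)} : Set (Sym2 (Fin 7)))

/-- The graph `𝔾₄ = 𝔾₃ + {2,7}`. -/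
def G4 : SimpleGraph (Fin 7) :=
  G3 ⊔ SimpleGraph.fromEdgeSet ({s(1, 6)} : Set (Sym2 (Fin 7)))

/-- The graph `𝔾₅ = 𝔾₄ + {1,7}`. -/
def G5 : SimpleGraph (Fin 7) :=
  G4 ⊔ SimpleGraph.fromEdgeSet ({s(0, 6)} : Set (Sym2 (Fin 7)))

/-- `abc` and `def` are triangles of `G` with no edge between them. -/
structure SeparatedTriangles {V : Type*} (G : SimpleGraph V) (a b c d e f : V) : Prop where
  ab : G.Adj a b
  ac : G.Adj a c
  bc : G.Adj b c
  de : G.Adj d e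
  df : G.Adj d f
  ef : G.Adj e f
  ad : ¬G.Adj a d
  ae : ¬G.Adj a e
  af : ¬G.Adj a f
  bd : ¬G.Adj b d
  be : ¬G.Adj b e
  bf : ¬G.Adj b f
  cd : ¬G.Adj c d
  ce : ¬G.Adj c e
  cf : ¬G.Adj c f

namespace SeparatedTriangles

variable {V : Type*} {G : SimpleGraph V} {a b c d e f : V}

theorem swap (h : SeparatedTriangles G a b c d e f) : SeparatedTriangles G d e f a b c := by
  obtain ⟨h1, h2, h3, h4, h5, h6, h7, h8, h9, h10, h11, h12, h13, h14, h15⟩ := h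
  constructor <;> first | assumption | (rw [G.adj_comm]; assumption)

theorem rotate (h : SeparatedTriangles G a b c d e f) : SeparatedTriangles G b c a d e f := by
  obtain ⟨h1, h2, h3, h4, h5, h6, h7, h8, h9, h10, h11, h12, h13, h14, h15⟩ := h
  constructor <;> first | assumption | (rw [G.adj_comm]; assumption)

theorem transpose (h : SeparatedTriangles G a b c d e f) : SeparatedTriangles G b a c d e f := by
  obtain ⟨h1, h2, h3, h4, h5, h6, h7, h8, h9, h10, h11, h12, h13, h14, h15⟩ := h
  constructor <;> first | assumption | (rw [G.adj_comm]; assumption)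

end SeparatedTriangles

/-- `G` contains an induced copy of `𝔾₃`, `𝔾₄` or `𝔾₅`. -/
def HasInducedG345 {V : Type*} (G : SimpleGraph V) : Prop :=
  Nonempty (G3 ↪g G) ∨ Nonempty (G4 ↪g G) ∨ Nonempty (G5 ↪g G)

section

variable {V : Type*} {G : SimpleGraph V} {a b c d e f v : V}

theorem injective_of_adj_iff {W : Type*} {H : SimpleGraph W} {φ : W → V}
    (hφ : ∀ i j, G.Adj (φ i) (φ j) ↔ H.Adj i j)
    (hH : ∀ i j, (∀ k, H.Adj i k ↔ H.Adj j k) → i = j) : Function.Injective φ := by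
  intro i j hij
  refine hH i j fun k => ?_
  rw [← hφ, ← hφ, hij]

instance : DecidableRel G3.Adj := fun i j => by unfold G3; infer_instance
instance : DecidableRel G4.Adj := fun i j => by unfold G4; infer_instance
instance : DecidableRel G5.Adj := fun i j => by unfold G5; infer_instance

theorem SeparatedTriangles.hasInducedG345_of_complete (h : SeparatedTriangles G a b c d e f)
    (hc : G.Adj c v) (hd : G.Adj d v) (he : G.Adj e v) (hf : G.Adj f v) :
    HasInducedG345 G := by
  wlog hab : G.Adj a v → G.Adj b v generalizing a b
  · exact this h.transpose (by tauto)
  have embed (H : SimpleGraph (Fin 7)) (hH : ∀ i j, (∀ k, H.Adj i k ↔ H.Adj j k) → i = j)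
      (hadj : ∀ i j, i < j →
        (G.Adj (![a, b, c, d, e, f, v] i) (![a, b, c, d, e, f, v] j) ↔ H.Adj i j)) :
      Nonempty (H ↪g G) := by
    have hadj' (i j) : G.Adj (![a, b, c, d, e, f, v] i) (![a, b, c, d, e, f, v] j) ↔
        H.Adj i j := by
      obtain hij | rfl | hij := lt_trichotomy i j
      · exact hadj i j hij
      · simp
      · rw [G.adj_comm, H.adj_comm, hadj j i hij]
    exact ⟨⟨⟨_, injective_of_adj_iff hadj' hH⟩, hadj' _ _⟩⟩
  obtain ⟨h1, h2, h3, h4, h5, h6, h7, h8, h9, h10, h11, h12, h13, h14, h15⟩ := h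
  by_cases hb : G.Adj b v
  · by_cases ha : G.Adj a v
    · refine Or.inr (.inr (embed G5 (by decide) fun i j hij => ?_))
      fin_cases i <;> fin_cases j <;> first
        | exact absurd hij (by decide)
        | exact iff_of_true (by assumption) (by decide)
        | exact iff_of_false (by assumption) (by decide)
    · refine Or.inr (.inl (embed G4 (by decide) fun i j hij => ?_))
      fin_cases i <;> fin_cases j <;> first
        | exact absurd hij (by decide)
        | exact iff_of_true (by assumption) (by decide)
        | exact iff_of_false (by assumption) (by decide)
  · have ha : ¬G.Adj a v := mt hab hb
    refine Or.inl (embed G3 (by decide) fun i j hij => ?_)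
    fin_cases i <;> fin_cases j <;> first
      | exact absurd hij (by decide)
      | exact iff_of_true (by assumption) (by decide)
      | exact iff_of_false (by assumption) (by decide)

theorem SeparatedTriangles.ne (h : SeparatedTriangles G a b c d e f) : a ≠ d := by
  rintro rfl
  exact h.bd h.ab.symm

theorem SeparatedTriangles.complete_or_complete (h : SeparatedTriangles G a b c d e f)
    (hα : ∀ i j k : V, i ≠ j → i ≠ k → j ≠ k → G.Adj i j ∨ G.Adj i k ∨ G.Adj j k)
    (hv : v ≠ a ∧ v ≠ b ∧ v ≠ c) (hv' : v ≠ d ∧ v ≠ e ∧ v ≠ f) :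
    (G.Adj a v ∧ G.Adj b v ∧ G.Adj c v) ∨ (G.Adj d v ∧ G.Adj e v ∧ G.Adj f v) := by
  have adj_or_adj {a b c d e f : V} (h : SeparatedTriangles G a b c d e f) (hx : v ≠ a)
      (hy : v ≠ d) : G.Adj a v ∨ G.Adj d v :=
    (hα a d v h.ne hx.symm hy.symm).resolve_left h.ad
  have forall_adj {a b c : V} (h : SeparatedTriangles G a b c d e f) (ha : v ≠ a) :
      G.Adj a v ∨ (G.Adj d v ∧ G.Adj e v ∧ G.Adj f v) := by
    have := adj_or_adj h ha hv'.1
    have := adj_or_adj h.swap.rotate.swap ha hv'.2.1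
    have := adj_or_adj h.swap.rotate.rotate.swap ha hv'.2.2
    tauto
  have := forall_adj h hv.1
  have := forall_adj h.rotate hv.2.1
  have := forall_adj h.rotate.rotate hv.2.2
  tauto

theorem SeparatedTriangles.hasInducedG345_of_adj (h : SeparatedTriangles G a b c d e f)
    (hα : ∀ i j k : V, i ≠ j → i ≠ k → j ≠ k → G.Adj i j ∨ G.Adj i k ∨ G.Adj j k)
    (hv : G.Adj a v ∨ G.Adj b v ∨ G.Adj c v) (hw : G.Adj d v ∨ G.Adj e v ∨ G.Adj f v) :
    HasInducedG345 G := by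
  have hne {a b c d e f : V} (h : SeparatedTriangles G a b c d e f)
      (hw : G.Adj d v ∨ G.Adj e v ∨ G.Adj f v) : v ≠ a ∧ v ≠ b ∧ v ≠ c := by
    have h' := h.swap
    refine ⟨?_, ?_, ?_⟩ <;> rintro rfl
    · exact hw.elim h'.ad (Or.elim · h'.bd h'.cd)
    · exact hw.elim h'.ae (Or.elim · h'.be h'.ce)
    · exact hw.elim h'.af (Or.elim · h'.bf h'.cf)
  obtain ⟨ha, hb, hc⟩ | ⟨hd, he, hf⟩ := h.complete_or_complete hα (hne h hw) (hne h.swap hv)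
  · obtain hd | he | hf := hw
    · exact h.swap.rotate.hasInducedG345_of_complete hd ha hb hc
    · exact h.swap.rotate.rotate.hasInducedG345_of_complete he ha hb hc
    · exact h.swap.hasInducedG345_of_complete hf ha hb hc
  · obtain ha | hb | hc := hv
    · exact h.rotate.hasInducedG345_of_complete ha hd he hf
    · exact h.rotate.rotate.hasInducedG345_of_complete hb hd he hf
    · exact h.hasInducedG345_of_complete hc hd he hf

theorem SeparatedTriangles.hasInducedG345 (h : SeparatedTriangles G a b c d e f)
    (hconn : G.Connected)
    (hα : ∀ i j k : V, i ≠ j → i ≠ k → j ≠ k → G.Adj i j ∨ G.Adj i k ∨ G.Adj j k) :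
    HasInducedG345 G := by
  by_cases hmixed : ∃ v, (G.Adj a v ∨ G.Adj b v ∨ G.Adj c v) ∧ (G.Adj d v ∨ G.Adj e v ∨ G.Adj f v)
  · obtain ⟨v, hv, hw⟩ := hmixed
    exact h.hasInducedG345_of_adj hα hv hw
  simp only [not_exists, not_and_or, not_or] at hmixed
  have hd : d ∉ {x | x = a ∨ G.Adj a x} := by
    rintro (rfl | had)
    · exact h.bd h.ab.symm
    · exact h.ad had
  obtain ⟨p⟩ := hconn.preconnected a d
  obtain ⟨⟨⟨u, w⟩, huw : G.Adj u w⟩, -, hu : u = a ∨ G.Adj a u, hw : ¬(w = a ∨ G.Adj a w)⟩ :=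
    p.exists_boundary_dart {x | x = a ∨ G.Adj a x} (.inl rfl) hd
  obtain ⟨hwa, haw⟩ := not_or.mp hw
  have hua : G.Adj a u := hu.resolve_left fun hua => haw (hua ▸ huw)
  have hu' : ¬G.Adj d u ∧ ¬G.Adj e u ∧ ¬G.Adj f u :=
    (hmixed u).resolve_left fun hn => hn.1 hua
  have hwbc : w ≠ b ∧ w ≠ c := ⟨fun hwb => haw (hwb ▸ h.ab), fun hwc => haw (hwc ▸ h.ac)⟩
  have hwdef : w ≠ d ∧ w ≠ e ∧ w ≠ f :=
    ⟨fun hwd => hu'.1 (hwd ▸ huw.symm), fun hwe => hu'.2.1 (hwe ▸ huw.symm),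
      fun hwf => hu'.2.2 (hwf ▸ huw.symm)⟩
  have hdw : G.Adj d w ∧ G.Adj e w ∧ G.Adj f w :=
    (h.complete_or_complete hα ⟨hwa, hwbc⟩ hwdef).resolve_left fun hn => haw hn.1
  have hw' : ¬G.Adj a w ∧ ¬G.Adj b w ∧ ¬G.Adj c w :=
    (hmixed w).resolve_right fun hn => hn.1 hdw.1
  have huabc : u ≠ a ∧ u ≠ b ∧ u ≠ c :=
    ⟨hua.ne.symm, fun hub => hw'.2.1 (hub ▸ huw), fun huc => hw'.2.2 (huc ▸ huw)⟩
  have hudef : u ≠ d ∧ u ≠ e ∧ u ≠ f :=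
    ⟨fun hud => h.ad (hud ▸ hua), fun hue => h.ae (hue ▸ hua), fun huf => h.af (huf ▸ hua)⟩
  have hau : G.Adj a u ∧ G.Adj b u ∧ G.Adj c u :=
    (h.complete_or_complete hα huabc hudef).resolve_right fun hn => hu'.1 hn.1
  have hsep : SeparatedTriangles G a b c d e w :=
    ⟨h.ab, h.ac, h.bc, h.de, hdw.1, hdw.2.1, h.ad, h.ae, hw'.1, h.bd, h.be, hw'.2.1, h.cd, h.ce,
      hw'.2.2⟩
  exact hsep.swap.hasInducedG345_of_complete huw.symm hau.1 hau.2.1 hau.2.2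

theorem SimpleGraph.Walk.IsCycle.exists_three_mem_support {p : G.Walk v v} (hp : p.IsCycle) :
    ∃ x ∈ p.support, ∃ y ∈ p.support, ∃ z ∈ p.support, x ≠ y ∧ x ≠ z ∧ y ≠ z :=
  ⟨v, p.start_mem_support, p.snd, p.getVert_mem_support _, p.penultimate,
    p.getVert_mem_support _, (p.adj_snd hp.not_nil).ne, (p.adj_penultimate hp.not_nil).ne.symm,
    hp.snd_ne_penultimate⟩

theorem HasTwoNonAdjOddCycles.exists_separatedTriangles (h : HasTwoNonAdjOddCycles G)
    (hα : ∀ i j k : V, i ≠ j → i ≠ k → j ≠ k → G.Adj i j ∨ G.Adj i k ∨ G.Adj j k) :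
    ∃ a b c d e f, SeparatedTriangles G a b c d e f := by
  obtain ⟨_, _, p, q, hp, hq, -, -, hpq⟩ := h
  obtain ⟨a, ha, b, hb, c, hc, hab, hac, hbc⟩ := hp.exists_three_mem_support
  obtain ⟨d, hd, e, he, f, hf, hde, hdf, hef⟩ := hq.exists_three_mem_support
  have adj_left {x y : V} (hx : x ∈ p.support) (hy : y ∈ p.support) (hxy : x ≠ y) : G.Adj x y := by
    have := hα x y d hxy (hpq x hx d hd).1 (hpq y hy d hd).1
    have := (hpq x hx d hd).2
    have := (hpq y hy d hd).2
    tauto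
  have adj_right {x y : V} (hx : x ∈ q.support) (hy : y ∈ q.support) (hxy : x ≠ y) :
      G.Adj x y := by
    have := hα a x y (hpq a ha x hx).1 (hpq a ha y hy).1 hxy
    have := (hpq a ha x hx).2
    have := (hpq a ha y hy).2
    tauto
  exact ⟨a, b, c, d, e, f, adj_left ha hb hab, adj_left ha hc hac, adj_left hb hc hbc,
    adj_right hd he hde, adj_right hd hf hdf, adj_right he hf hef,
    (hpq a ha d hd).2, (hpq a ha e he).2, (hpq a ha f hf).2,
    (hpq b hb d hd).2, (hpq b hb e he).2, (hpq b hb f hf).2,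
    (hpq c hc d hd).2, (hpq c hc e he).2, (hpq c hc f hf).2⟩

theorem SeparatedTriangles.hasTwoNonAdjOddCycles (h : SeparatedTriangles G a b c d e f) :
    HasTwoNonAdjOddCycles G := by
  have triangle {x y z : V} (hxy : G.Adj x y) (hxz : G.Adj x z) (hyz : G.Adj y z) :
      (SimpleGraph.Walk.cons hxy (.cons hyz (.cons hxz.symm .nil))).IsCycle := by
    simp [SimpleGraph.Walk.cons_isCycle_iff, hxy.ne, hxy.ne.symm, hxz.ne, hxz.ne.symm, hyz.ne]
  refine ⟨a, d, _, _, triangle h.ab h.ac h.bc, triangle h.de h.df h.ef, ⟨1, rfl⟩, ⟨1, rfl⟩, ?_⟩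
  obtain ⟨h1, h2, h3, h4, h5, h6, h7, h8, h9, h10, h11, h12, h13, h14, h15⟩ := h
  simp only [SimpleGraph.Walk.support_cons, SimpleGraph.Walk.support_nil, List.mem_cons]
  grind [G.adj_comm]

theorem SeparatedTriangles.map {W : Type*} {H : SimpleGraph W} {a b c d e f : W}
    (h : SeparatedTriangles H a b c d e f) (φ : H ↪g G) :
    SeparatedTriangles G (φ a) (φ b) (φ c) (φ d) (φ e) (φ f) := by
  obtain ⟨h1, h2, h3, h4, h5, h6, h7, h8, h9, h10, h11, h12, h13, h14, h15⟩ := h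
  constructor <;> rwa [φ.map_adj_iff]

theorem separatedTriangles_G3 : SeparatedTriangles G3 0 1 2 3 4 5 := by
  constructor <;> decide

theorem separatedTriangles_G4 : SeparatedTriangles G4 0 1 2 3 4 5 := by
  constructor <;> decide

theorem separatedTriangles_G5 : SeparatedTriangles G5 0 1 2 3 4 5 := by
  constructor <;> decide

end

/-- Let `G` be a connected finite simple graph with independence number
`α(G) ≤ 2` (any three pairwise distinct vertices span an edge). Then `G` contains two odd
cycles which are not adjacent to each other iff `G` contains an induced subgraph
isomorphic to one of `𝔾₃`, `𝔾₄`, `𝔾₅`. -/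
theorem statement13 {V : Type*} [Fintype V] (G : SimpleGraph V) (hconn : G.Connected)
    (hα : ∀ i j k : V, i ≠ j → i ≠ k → j ≠ k → G.Adj i j ∨ G.Adj i k ∨ G.Adj j k) :
    HasTwoNonAdjOddCycles G ↔
      (Nonempty (G3 ↪g G) ∨ Nonempty (G4 ↪g G) ∨ Nonempty (G5 ↪g G)) := by
  constructor
  · intro h
    obtain ⟨_, _, _, _, _, _, hsep⟩ := h.exists_separatedTriangles hα
    exact hsep.hasInducedG345 hconn hα
  · rintro (h | h | h) <;> obtain ⟨φ⟩ := h
    · exact (separatedTriangles_G3.map φ).hasTwoNonAdjOddCycles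
    · exact (separatedTriangles_G4.map φ).hasTwoNonAdjOddCycles
    · exact (separatedTriangles_G5.map φ).hasTwoNonAdjOddCycles
end

section
/- Let S = K[x₁,x₂,x₃,x₄] over a field K and let I = (x₁x₂x₃, x₁x₄, x₂x₄) (the Stanley–Reisner ideal of the graph 𝔾₁ with edges {1,2},{1,3},{2,3},{3,4}). Then for every integer n ≥ 1 there is no 0-th critical monomial of I^n; equivalently, a_0(S/I^n) = −∞ (i.e., H^0_m(S/I^n) = 0) for all n ≥ 1. -/
open MvPolynomial

/-- `a` is the exponent vector of a 0-th critical monomial of the monomial ideal `J`: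
`x^a ∉ J` and for every variable `x i` some power `x i ^ t` (`t ≥ 1`) multiplies `x^a` into `J`. -/
def IsCritical {s : ℕ} {K : Type*} [Field K] (J : Ideal (MvPolynomial (Fin s) K))
    (a : Fin s →₀ ℕ) : Prop :=
  monomial a (1 : K) ∉ J ∧
    ∀ i : Fin s, ∃ t : ℕ, 1 ≤ t ∧ X i ^ t * monomial a (1 : K) ∈ J

/-- Monomials in the `n`-th power of `(x₁x₂x₃, x₁x₄, x₂x₄)` are those divisible by some
product `(x₁x₂x₃)^p (x₁x₄)^q (x₂x₄)^r` with `p + q + r = n`. -/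
theorem monomial_mem_pow_iff (K : Type*) [Field K] (n : ℕ) (a : Fin 4 →₀ ℕ) :
    monomial a (1 : K) ∈ (Ideal.span {(X 0 * X 1 * X 2 : MvPolynomial (Fin 4) K),
        X 0 * X 3, X 1 * X 3}) ^ n ↔
      ∃ p q r : ℕ, p + q + r = n ∧ p + q ≤ a 0 ∧ p + r ≤ a 1 ∧ p ≤ a 2 ∧ q + r ≤ a 3 := by
  constructor
  · let E : ℕ → Set (Fin 4 →₀ ℕ) := fun n => {b | ∃ p q r : ℕ, p + q + r = n ∧
      p + q ≤ b 0 ∧ p + r ≤ b 1 ∧ p ≤ b 2 ∧ q + r ≤ b 3}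
    have generators_mem : Ideal.span {(X 0 * X 1 * X 2 : MvPolynomial (Fin 4) K),
        X 0 * X 3, X 1 * X 3} ≤ Ideal.span ((fun b => monomial b (1 : K)) '' E 1) := by
      rw [Ideal.span_le]
      rintro f (rfl | rfl | rfl) <;> refine Ideal.subset_span ?_
      · refine ⟨Finsupp.single 0 1 + Finsupp.single 1 1 + Finsupp.single 2 1,
          ⟨1, 0, 0, ?_⟩, by simp [X, monomial_mul]⟩
        simp
      · refine ⟨Finsupp.single 0 1 + Finsupp.single 3 1,
          ⟨0, 1, 0, ?_⟩, by simp [X, monomial_mul]⟩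
        simp
      · refine ⟨Finsupp.single 1 1 + Finsupp.single 3 1,
          ⟨0, 0, 1, ?_⟩, by simp [X, monomial_mul]⟩
        simp
    have pow_le : ∀ n, (Ideal.span {(X 0 * X 1 * X 2 : MvPolynomial (Fin 4) K),
        X 0 * X 3, X 1 * X 3}) ^ n ≤ Ideal.span ((fun b => monomial b (1 : K)) '' E n) := by
      intro n
      induction n with
      | zero =>
        have one_mem : (1 : MvPolynomial (Fin 4) K) ∈
            Ideal.span ((fun b => monomial b (1 : K)) '' E 0) :=
          Ideal.subset_span ⟨0, ⟨0, 0, 0, by simp⟩, rfl⟩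
        rw [(Ideal.eq_top_iff_one _).2 one_mem]
        exact le_top
      | succ n ih =>
        rw [pow_succ]
        refine (Ideal.mul_mono ih generators_mem).trans ?_
        rw [Ideal.span_mul_span', Ideal.span_le]
        rintro _ ⟨_, ⟨b, ⟨p, q, r, hb⟩, rfl⟩, _, ⟨c, ⟨p', q', r', hc⟩, rfl⟩, rfl⟩
        refine Ideal.subset_span ⟨b + c, ⟨p + p', q + q', r + r', ?_⟩, by simp [monomial_mul]⟩
        simp only [Finsupp.add_apply]
        omega
    intro h
    obtain ⟨b, ⟨p, q, r, hb⟩, hba⟩ :=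
      mem_ideal_span_monomial_image.1 (pow_le n h) a (by simp [mem_support_iff])
    have h0 := hba 0
    have h1 := hba 1
    have h2 := hba 2
    have h3 := hba 3
    exact ⟨p, q, r, by omega⟩
  · rintro ⟨p, q, r, rfl, h0, h1, h2, h3⟩
    have mem : (X 0 * X 1 * X 2 : MvPolynomial (Fin 4) K) ^ p * (X 0 * X 3) ^ q * (X 1 * X 3) ^ r ∈
        (Ideal.span {(X 0 * X 1 * X 2 : MvPolynomial (Fin 4) K),
          X 0 * X 3, X 1 * X 3}) ^ (p + q + r) := by
      rw [pow_add, pow_add]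
      refine Ideal.mul_mem_mul (Ideal.mul_mem_mul ?_ ?_) ?_ <;>
        exact Ideal.pow_mem_pow (Ideal.subset_span (by simp)) _
    refine Ideal.mem_of_dvd _ ?_ mem
    obtain ⟨d0, h0⟩ := Nat.exists_eq_add_of_le h0
    obtain ⟨d1, h1⟩ := Nat.exists_eq_add_of_le h1
    obtain ⟨d2, h2⟩ := Nat.exists_eq_add_of_le h2
    obtain ⟨d3, h3⟩ := Nat.exists_eq_add_of_le h3
    refine ⟨X 0 ^ d0 * X 1 ^ d1 * X 2 ^ d2 * X 3 ^ d3, ?_⟩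
    rw [monomial_eq, Finsupp.prod_fintype _ _ (by simp)]
    simp only [Fin.prod_univ_four, h0, h1, h2, h3, C_1]
    ring

/-- Let `S = K[x₁,x₂,x₃,x₄]` and
`I = (x₁x₂x₃, x₁x₄, x₂x₄)` (the Stanley–Reisner ideal of `𝔾₁`). Then for every `n ≥ 1`
there is no 0-th critical monomial of `I^n`, i.e. `a₀(S/I^n) = −∞`. -/
theorem statement14 (K : Type*) [Field K] :
    ∀ n : ℕ, 1 ≤ n →
      ¬ ∃ a : Fin 4 →₀ ℕ,
        IsCritical
          ((Ideal.span {(X 0 * X 1 * X 2 : MvPolynomial (Fin 4) K),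
            X 0 * X 3, X 1 * X 3}) ^ n) a := by
  rintro n - ⟨a, hnot, hcrit⟩
  have shift : ∀ (i : Fin 4) (t : ℕ),
      X i ^ t * monomial a (1 : K) = monomial (Finsupp.single i t + a) (1 : K) := by
    intro i t
    rw [X_pow_eq_monomial, monomial_mul, one_mul]
  obtain ⟨t, -, ht⟩ := hcrit 0
  obtain ⟨u, -, hu⟩ := hcrit 2
  rw [shift, monomial_mem_pow_iff] at ht hu
  rw [monomial_mem_pow_iff] at hnot
  obtain ⟨p, q, r, hpqr⟩ := ht
  obtain ⟨p', q', r', hpqr'⟩ := hu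
  simp at hpqr hpqr'
  refine hnot ?_
  rcases le_total p' (a 2) with h | h
  · exact ⟨p', q', r', by omega⟩
  · exact ⟨a 2, q' + (p' - a 2), r', by omega⟩
end
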